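/- arXiv:1711.05832 — 9 statements merged into one kernel-verified Lean document; each statement's English description precedes it below -/
import Mathlib

section
/- Let p be a prime and H a finite group of p-rank r, and let G = H ≀ Z/p. Then for every element w of G not lying in the base subgroup H^p, every elementary abelian p-subgroup of the base subgroup H^p that is centralized by w has rank at most r. -/
/-- The shift automorphism of the direct power `ZMod p → H` by `k : ZMod p`. -/
def shiftAut (p : ℕ) (H : Type*) [Group H] (k : ZMod p) : MulAut (ZMod p → H) where
  toFun f := fun i => f (i + k)
  invFun f := fun i => f (i - k)
  left_inv f := by funext i; simp
  right_inv f := by funext i; simp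
  map_mul' f g := rfl

/-- The shift action of `ZMod p` on the direct power `ZMod p → H`. -/
def shiftHom (p : ℕ) (H : Type*) [Group H] :
    Multiplicative (ZMod p) →* MulAut (ZMod p → H) where
  toFun k := shiftAut p H k.toAdd
  map_one' := by
    ext f i
    show f (i + Multiplicative.toAdd 1) = f i
    simp
  map_mul' a b := by
    ext f i
    show f (i + Multiplicative.toAdd (a * b)) = f (i + Multiplicative.toAdd a + Multiplicative.toAdd b)
    rw [toAdd_mul, add_assoc]

/-- The wreath product `H ≀ ℤ/p`. -/
abbrev WreathZp (p : ℕ) (H : Type*) [Group H] : Type _ :=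
  SemidirectProduct (ZMod p → H) (Multiplicative (ZMod p)) (shiftHom p H)

/-- The inclusion of the base subgroup `H^p` into the wreath product. -/
abbrev wreathInl (p : ℕ) (H : Type*) [Group H] : (ZMod p → H) →* WreathZp p H :=
  SemidirectProduct.inl

/-- The base subgroup `H^p` of the wreath product, i.e. the elements with trivial
`ZMod p` component. -/
def wreathBase (p : ℕ) (H : Type*) [Group H] : Subgroup (WreathZp p H) :=
  (wreathInl p H).range

/-- `E` is an elementary abelian `p`-subgroup (a `p`-torus) of rank `r`, i.e. `E` is
isomorphic to `(ZMod p)^r`. -/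
def IsPTorus (p : ℕ) {G : Type*} [Group G] (E : Subgroup G) (r : ℕ) : Prop :=
  Nonempty (E ≃* (Fin r → Multiplicative (ZMod p)))

/-- The `p`-rank of a group: the maximal rank of an elementary abelian `p`-subgroup. -/
noncomputable def pRank (p : ℕ) (G : Type*) [Group G] : ℕ :=
  sSup {r | ∃ E : Subgroup G, IsPTorus p E r}

/-- if `H` is a finite group of `p`-rank `r` and `w ∈ H ≀ ℤ/p` does not lie
in the base subgroup `H^p`, then every elementary abelian `p`-subgroup of the base
subgroup centralized by `w` has rank at most `r`. -/
theorem stmt1 (p : ℕ) (hp : p.Prime) (H : Type*) [Group H] [Finite H]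
    (r : ℕ) (hr : pRank p H = r)
    (w : WreathZp p H) (hw : w ∉ wreathBase p H)
    (E : Subgroup (ZMod p → H))
    (hcent : ∀ x ∈ E, Commute (wreathInl p H x) w)
    (s : ℕ) (hE : IsPTorus p E s) : s ≤ r := by
  haveI : Fact p.Prime := ⟨hp⟩
  obtain ⟨e⟩ := hE
  set k : ZMod p := Multiplicative.toAdd w.right with hk
  have hk0 : k ≠ 0 := by
    intro h
    apply hw
    refine ⟨w.left, ?_⟩
    have h1 : w.right = 1 := by
      apply Multiplicative.toAdd.injective
      exact h
    apply SemidirectProduct.ext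
    · simp
    · simp [h1]
  have hstep : ∀ x ∈ E, ∀ i, x i = 1 → x (i + k) = 1 := by
    intro x hx i hi
    have h := congrArg (fun g : WreathZp p H => g.left i) (hcent x hx).eq
    simp only [SemidirectProduct.mul_left, SemidirectProduct.left_inl,
      SemidirectProduct.right_inl, map_one, MulAut.one_apply, Pi.mul_apply, hi, one_mul] at h
    have h2 : (shiftHom p H w.right) x i = x (i + k) := rfl
    rw [h2] at h
    exact (left_eq_mul.mp h)
  have hinj : Function.Injective ((Pi.evalMonoidHom (fun _ : ZMod p => H) 0).comp E.subtype) := by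
    rw [injective_iff_map_eq_one]
    rintro ⟨x, hx⟩ h0
    have h0' : x 0 = 1 := h0
    have hn : ∀ n : ℕ, x ((n : ZMod p) * k) = 1 := by
      intro n
      induction n with
      | zero => simpa using h0'
      | succ n ih =>
        have := hstep x hx _ ih
        rwa [Nat.cast_succ, add_mul, one_mul]
    apply Subtype.ext
    funext i
    have h3 := hn (i * k⁻¹).val
    rw [ZMod.natCast_zmod_val, inv_mul_cancel_right₀ hk0] at h3
    exact h3
  rw [← hr]
  apply le_csSup
  · refine ⟨Nat.card H, ?_⟩
    rintro t ⟨F, ⟨f⟩⟩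
    have hc : Nat.card F = p ^ t := by
      rw [Nat.card_congr f.toEquiv, Nat.card_fun]
      simp
    have h4 : Nat.card F ≤ Nat.card H := Nat.card_le_card_of_injective _ F.subtype_injective
    rw [hc] at h4
    exact (Nat.lt_pow_self hp.one_lt).le.trans h4
  · exact ⟨_, ⟨(MonoidHom.ofInjective hinj).symm.trans e⟩⟩
end

section
/- Let p be a prime and H a finite p-group of p-rank r, and let G = H ≀ Z/p. Then for every elementary abelian p-subgroup E of G with rank at least r + 2, the centralizer C_G(E) is contained in the base subgroup H^p. (In other words, the extension H^p → G → Z/p is (r+2)-trivial.) -/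
/-- A subgroup `H` of `G` is `i`-trivial if the centralizer of every elementary abelian
`p`-subgroup of rank at least `i` is contained in `H`. -/
def ITrivial (p : ℕ) {G : Type*} [Group G] (H : Subgroup G) (i : ℕ) : Prop :=
  ∀ (E : Subgroup G) (r : ℕ), i ≤ r → IsPTorus p E r →
    Subgroup.centralizer (E : Set G) ≤ H


/-- A torus of rank `m` mapping to `ℤ/p` has a torus of rank `≥ m-1` in the kernel. -/
lemma torus_ker (p : ℕ) [Fact p.Prime] (m : ℕ)
    (φ : (Fin m → Multiplicative (ZMod p)) →* Multiplicative (ZMod p)) :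
    ∃ (s : ℕ) (θ : (Fin s → Multiplicative (ZMod p)) →* (Fin m → Multiplicative (ZMod p))),
      m ≤ s + 1 ∧ Function.Injective θ ∧ ∀ x, φ (θ x) = 1 := by
  let ψ0 : (Fin m → ZMod p) →+ ZMod p :=
    { toFun := fun v => (φ (fun i => Multiplicative.ofAdd (v i))).toAdd
      map_zero' := by
        have := φ.map_one
        exact congrArg Multiplicative.toAdd this
      map_add' := fun a b => by
        have := φ.map_mul (fun i => Multiplicative.ofAdd (a i)) (fun i => Multiplicative.ofAdd (b i))
        exact congrArg Multiplicative.toAdd this }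
  let ψ : (Fin m → ZMod p) →ₗ[ZMod p] ZMod p := ψ0.toZModLinearMap p
  let W := LinearMap.ker ψ
  let e := (Module.finBasis (ZMod p) W).equivFun.symm
  refine ⟨Module.finrank (ZMod p) W,
    MonoidHom.mk' (fun x i => Multiplicative.ofAdd
      ((e (fun j => (x j).toAdd) : Fin m → ZMod p) i)) ?_, ?_, ?_, ?_⟩
  · intro a b
    have h := e.map_add (fun j => (a j).toAdd) (fun j => (b j).toAdd)
    funext i
    exact congrArg (fun w : W => Multiplicative.ofAdd ((w : Fin m → ZMod p) i)) h
  · have h1 := ψ.finrank_range_add_finrank_ker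
    have h2 := Submodule.finrank_le (LinearMap.range ψ)
    rw [Module.finrank_self] at h2
    rw [Module.finrank_fin_fun] at h1
    change m ≤ Module.finrank (ZMod p) (LinearMap.ker ψ) + 1
    omega
  · intro a b hab
    have h : e (fun j => (a j).toAdd) = e (fun j => (b j).toAdd) := by
      apply Subtype.ext
      exact hab
    exact e.injective h
  · intro x
    have h : ψ (e (fun j => (x j).toAdd) : Fin m → ZMod p) = 0 :=
      (e (fun j => (x j).toAdd)).2
    exact h

lemma le_pRank (p : ℕ) [Fact p.Prime] (H : Type*) [Group H] [Finite H] (s : ℕ)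
    (θ : (Fin s → Multiplicative (ZMod p)) →* H) (hθ : Function.Injective θ) :
    s ≤ pRank p H := by
  have hp : p.Prime := Fact.out
  apply le_csSup
  · refine ⟨Nat.card H, ?_⟩
    rintro t ⟨E, ⟨e⟩⟩
    have h1 : Nat.card E = p ^ t := by
      rw [Nat.card_congr e.toEquiv]
      simp [Nat.card_pi]
    have h2 := Subgroup.card_le_card_group E
    have h3 := Nat.lt_pow_self hp.one_lt (n := t)
    omega
  · exact ⟨θ.range, ⟨(MonoidHom.ofInjective hθ).symm⟩⟩

lemma eval_inj (p : ℕ) [Fact p.Prime] (H : Type*) [Group H] (g h : WreathZp p H)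
    (hg : g.right ≠ 1) (hr : h.right = 1) (hc : h * g = g * h) (h0 : h.left 0 = 1) :
    h = 1 := by
  have key : ∀ i, h.left i = 1 → h.left (i + g.right.toAdd) = 1 := by
    intro i hi
    have h1 : (h * g).left i = (g * h).left i := by rw [hc]
    rw [SemidirectProduct.mul_left, SemidirectProduct.mul_left, hr, map_one] at h1
    change h.left i * g.left i = g.left i * h.left (i + g.right.toAdd) at h1
    rw [hi, one_mul] at h1
    exact (mul_eq_left.mp h1.symm)
  have key2 : ∀ n : ℕ, h.left ((n : ZMod p) * g.right.toAdd) = 1 := by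
    intro n
    induction n with
    | zero => simpa using h0
    | succ n ih =>
      have := key _ ih
      rw [Nat.cast_succ, add_mul, one_mul]
      exact this
  have hk : g.right.toAdd ≠ 0 := fun hh => hg hh
  apply SemidirectProduct.ext
  · funext i
    have h2 := key2 (i / g.right.toAdd).val
    rw [ZMod.natCast_zmod_val, div_mul_cancel₀ _ hk] at h2
    exact h2
  · exact hr

/-- if `H` is a finite `p`-group of `p`-rank `r`, then the base subgroup
`H^p` is `(r+2)`-trivial in `H ≀ ℤ/p`: the centralizer of every elementary abelian
`p`-subgroup of `H ≀ ℤ/p` of rank at least `r + 2` is contained in the base subgroup. -/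
theorem stmt2 (p : ℕ) (hp : p.Prime) (H : Type*) [Group H] [Finite H]
    (hpH : IsPGroup p H) (r : ℕ) (hr : pRank p H = r) :
    ITrivial p (wreathBase p H) (r + 2) := by
  haveI : Fact p.Prime := ⟨hp⟩
  rintro E m hm ⟨e⟩ g hg
  by_contra hgb
  have hg1 : g.right ≠ 1 := by
    intro h
    apply hgb
    exact ⟨g.left, SemidirectProduct.ext (by simp) (by simp [h])⟩
  obtain ⟨s, θ, hs, hθ, hk⟩ := torus_ker p m
    ((SemidirectProduct.rightHom.comp E.subtype).comp e.symm.toMonoidHom)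
  let η : (Fin s → Multiplicative (ZMod p)) →* WreathZp p H :=
    (E.subtype.comp e.symm.toMonoidHom).comp θ
  have hη : Function.Injective η :=
    (Subtype.val_injective.comp e.symm.injective).comp hθ
  have hηr : ∀ x, (η x).right = 1 := hk
  have hηc : ∀ x, η x * g = g * η x := fun x =>
    Subgroup.mem_centralizer_iff.mp hg _ (e.symm (θ x)).2
  let ρ : (Fin s → Multiplicative (ZMod p)) →* H :=
    MonoidHom.mk' (fun x => (η x).left 0) (by
      intro a b
      rw [map_mul, SemidirectProduct.mul_left, hηr, map_one]
      rfl)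
  have hρ : Function.Injective ρ := by
    rw [injective_iff_map_eq_one]
    intro x hx
    have := eval_inj p H g (η x) hg1 (hηr x) (hηc x) hx
    exact (injective_iff_map_eq_one η).mp hη x this
  have := le_pRank p H s ρ hρ
  omega
end

section
/- Let p be a prime, G a finite group, H a subgroup of G, and i a natural number with i at most the p-rank of G. Suppose H is i-trivial in G, i.e. for every elementary abelian p-subgroup E of G of rank at least i, the centralizer C_G(E) is contained in H. Let r be the p-rank of H and let n ≥ 1. Then for every elementary abelian p-subgroup E of the direct power G^n = (Fin n → G) of rank at least (n−1)·r + i, the centralizer of E in G^n is contained in H^n = (Fin n → H). -/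
theorem exists_torus_equiv (p : ℕ) (hp : p.Prime) (K : Type*) [Group K] [Finite K]
    (hc : ∀ x y : K, x * y = y * x) (ht : ∀ x : K, x ^ p = 1) :
    ∃ s : ℕ, Nonempty (K ≃* (Fin s → Multiplicative (ZMod p))) := by
  have : Fact p.Prime := ⟨hp⟩
  let : CommGroup K := { (inferInstance : Group K) with mul_comm := hc }
  let : Module (ZMod p) (Additive K) := AddCommGroup.zmodModule (n := p) (fun x => ht x.toMul)
  have : Module.Finite (ZMod p) (Additive K) := Module.Finite.of_finite
  let e := (Module.finBasis (ZMod p) (Additive K)).equivFun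
  refine ⟨_, ⟨{ toFun := fun k j => Multiplicative.ofAdd (e (Additive.ofMul k) j)
                invFun := fun f => (e.symm (fun j => (f j).toAdd)).toMul
                left_inv := ?_
                right_inv := ?_
                map_mul' := ?_ }⟩⟩
  · intro k
    exact congrArg Additive.toMul (e.symm_apply_apply (Additive.ofMul k))
  · intro f
    funext j
    exact congrFun (e.apply_symm_apply (fun j => (f j).toAdd)) j
  · intro x y
    funext j
    exact congrFun (e.map_add (Additive.ofMul x) (Additive.ofMul y)) j

theorem IsPTorus.comm' {p : ℕ} {G : Type*} [Group G] {E : Subgroup G} {r : ℕ}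
    (h : IsPTorus p E r) {x y : G} (hx : x ∈ E) (hy : y ∈ E) : x * y = y * x := by
  obtain ⟨e⟩ := h
  have : (⟨x, hx⟩ : E) * ⟨y, hy⟩ = ⟨y, hy⟩ * ⟨x, hx⟩ := by
    apply e.injective
    rw [map_mul, map_mul, mul_comm]
  exact congrArg Subtype.val this

theorem IsPTorus.pow' {p : ℕ} {G : Type*} [Group G] {E : Subgroup G} {r : ℕ}
    (h : IsPTorus p E r) {x : G} (hx : x ∈ E) : x ^ p = 1 := by
  obtain ⟨e⟩ := h
  have : (⟨x, hx⟩ : E) ^ p = 1 := by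
    apply e.injective
    rw [map_pow, map_one]
    funext j
    apply Multiplicative.toAdd.injective
    simp
  exact congrArg Subtype.val this

theorem IsPTorus.card' {p : ℕ} {G : Type*} [Group G] {E : Subgroup G} {r : ℕ}
    (h : IsPTorus p E r) : Nat.card E = p ^ r := by
  obtain ⟨e⟩ := h
  have hz : Nat.card (Multiplicative (ZMod p)) = p := Nat.card_zmod p
  rw [Nat.card_congr e.toEquiv, Nat.card_fun, hz, Nat.card_fin]

theorem bdd_torus (p : ℕ) (hp : p.Prime) (G : Type*) [Group G] [Finite G] :
    BddAbove {r | ∃ E : Subgroup G, IsPTorus p E r} := by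
  refine ⟨Nat.card G, ?_⟩
  rintro r ⟨E, hE⟩
  have h1 := E.card_le_card_group
  rw [hE.card'] at h1
  exact (Nat.lt_pow_self hp.one_lt).le.trans h1

theorem stmt3 (p : ℕ) (hp : p.Prime) (G : Type*) [Group G] [Finite G]
    (H : Subgroup G) (i : ℕ) (hi : i ≤ pRank p G) (htriv : ITrivial p H i)
    (n : ℕ) (hn : 1 ≤ n) :
    ITrivial p (Subgroup.pi (Set.univ : Set (Fin n)) fun _ => H)
      ((n - 1) * pRank p ↥H + i) := by
  have key : ∀ (E : Subgroup G) (r : ℕ), i ≤ r → IsPTorus p E r → r ≤ pRank p H := by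
    intro E r hr hE
    have hEH : E ≤ H := fun x hx => htriv E r hr hE
      (Subgroup.mem_centralizer_iff.mpr fun y hy => hE.comm' hy hx)
    refine le_csSup (bdd_torus p hp H) ⟨E.subgroupOf H, ?_⟩
    obtain ⟨e⟩ := hE
    exact ⟨(Subgroup.subgroupOfEquivOfLe hEH).trans e⟩
  have hne : {r | ∃ E : Subgroup G, IsPTorus p E r}.Nonempty := by
    obtain ⟨s, ⟨e⟩⟩ := exists_torus_equiv p hp (⊥ : Subgroup G)
      (fun x y => Subsingleton.elim _ _) (fun x => Subsingleton.elim _ _)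
    exact ⟨s, ⊥, ⟨e⟩⟩
  have hiH : i ≤ pRank p H := by
    obtain ⟨E, hE⟩ := Nat.sSup_mem hne (bdd_torus p hp G)
    exact hi.trans (key E _ hi hE)
  have key2 : ∀ (E : Subgroup G) (r : ℕ), IsPTorus p E r → r ≤ pRank p H := by
    intro E r hE
    rcases le_total i r with h | h
    · exact key E r h hE
    · exact h.trans hiH
  intro E s hs hE c hc
  have hproj : ∀ j : Fin n, ∃ t, IsPTorus p (E.map (Pi.evalMonoidHom (fun _ : Fin n => G) j)) t := by
    intro j
    apply exists_torus_equiv p hp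
    · rintro ⟨_, x, hx, rfl⟩ ⟨_, y, hy, rfl⟩
      apply Subtype.ext
      exact congrFun (hE.comm' hx hy) j
    · rintro ⟨_, x, hx, rfl⟩
      apply Subtype.ext
      exact congrFun (hE.pow' hx) j
  choose t ht using hproj
  have hcard : Nat.card E ≤
      Nat.card (∀ j : Fin n, E.map (Pi.evalMonoidHom (fun _ : Fin n => G) j)) := by
    refine Nat.card_le_card_of_injective
      (fun x j => ⟨x.1 j, x.1, x.2, rfl⟩) ?_
    intro x y hxy
    apply Subtype.ext
    funext j
    exact congrArg Subtype.val (congrFun hxy j)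
  rw [Nat.card_pi, hE.card'] at hcard
  simp only [fun j => (ht j).card'] at hcard
  rw [Finset.prod_pow_eq_pow_sum, Nat.pow_le_pow_iff_right hp.one_lt] at hcard
  rw [Subgroup.mem_pi]
  intro j _
  have hsum : ∑ k, t k ≤ t j + (n - 1) * pRank p H := by
    rw [← Finset.add_sum_erase _ _ (Finset.mem_univ j)]
    have := Finset.sum_le_card_nsmul (Finset.univ.erase j) t (pRank p H)
      (fun k _ => key2 _ _ (ht k))
    rw [Finset.card_erase_of_mem (Finset.mem_univ j), Finset.card_univ, Fintype.card_fin,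
      smul_eq_mul] at this
    exact Nat.add_le_add_left this _
  refine htriv _ (t j) (by omega) (ht j) (Subgroup.mem_centralizer_iff.mpr ?_)
  rintro _ ⟨x, hx, rfl⟩
  exact congrFun (Subgroup.mem_centralizer_iff.mp hc x hx) j
end

section
/- Let p ≥ 5 be a prime and n ≥ 2. Then E(n) is a normal subgroup of the iterated wreath product W(n), E(n) is elementary abelian of rank p^{n−1} (i.e. isomorphic to (ZMod p)^{p^{n−1}}), and the quotient group W(n)/E(n) is isomorphic to W(n−1). -/
/-- For a subgroup `K ≤ H`, the subgroup `K^p = (ZMod p → K)` of the base subgroup of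
the wreath product `H ≀ ℤ/p`. -/
def wreathBasePow (p : ℕ) {H : Type*} [Group H] (K : Subgroup H) :
    Subgroup (WreathZp p H) :=
  (Subgroup.pi (Set.univ : Set (ZMod p)) fun _ => K).map (wreathInl p H)

/-- Auxiliary bundled construction of the iterated wreath products. -/
def WAux (p : ℕ) : ℕ → Σ G : Type, Group G
  | 0 => ⟨Multiplicative (ZMod p), inferInstance⟩
  | 1 => ⟨Multiplicative (ZMod p), inferInstance⟩
  | (n + 2) =>
      letI := (WAux p (n + 1)).2
      ⟨WreathZp p (WAux p (n + 1)).1, inferInstance⟩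

/-- The iterated wreath product `W(n)`: `W(1) = ℤ/p` and `W(n) = W(n-1) ≀ ℤ/p`,
a Sylow `p`-subgroup of the symmetric group on `p^n` letters. -/
def W (p n : ℕ) : Type := (WAux p n).1

instance instGroupW (p n : ℕ) : Group (W p n) := (WAux p n).2

/-- The subgroup `E(n) ≤ W(n)`: `E(1) = W(1)` and `E(n) = E(n-1)^p`, the subgroup
`(ZMod p → E(n-1))` of the base subgroup of `W(n) = W(n-1) ≀ ℤ/p`. -/
def EW (p : ℕ) : (n : ℕ) → Subgroup (W p n)
  | 0 => ⊤
  | 1 => ⊤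
  | (n + 2) => wreathBasePow (H := W p (n + 1)) p (EW p (n + 1))

theorem wreathMap_exists (p : ℕ) {H K : Type*} [Group H] [Group K] (f : H →* K)
    (hf : Function.Surjective f) :
    ∃ g : WreathZp p H →* WreathZp p K, Function.Surjective g ∧
      g.ker = wreathBasePow p f.ker := by
  refine ⟨⟨⟨fun x => ⟨fun i => f (x.left i), x.right⟩, ?_⟩, ?_⟩, ?_, ?_⟩
  · ext i
    · exact map_one f
    · rfl
  · intro x y
    ext i
    · exact map_mul f _ _
    · rfl
  · intro y
    choose s hs using hf
    refine ⟨⟨fun i => s (y.left i), y.right⟩, ?_⟩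
    ext i
    · exact hs _
    · rfl
  · ext x
    rw [MonoidHom.mem_ker]
    constructor
    · intro h
      refine ⟨x.left, ?_, ?_⟩
      · intro i _
        exact congrFun (congrArg SemidirectProduct.left h) i
      · have h2 := congrArg SemidirectProduct.right h
        ext i
        · rfl
        · exact h2.symm
    · rintro ⟨y, hy, rfl⟩
      ext i
      · exact hy i trivial
      · rfl

theorem wreathRight_ker (p : ℕ) (H : Type*) [Group H] :
    (SemidirectProduct.rightHom : WreathZp p H →* Multiplicative (ZMod p)).ker
      = wreathBasePow p (⊤ : Subgroup H) := by
  rw [← SemidirectProduct.range_inl_eq_ker_rightHom, MonoidHom.range_eq_map, wreathBasePow]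
  congr 1
  ext x
  simp [Subgroup.mem_pi]

theorem wreathBasePow_torus (p : ℕ) (hp : p ≠ 0) {H : Type*} [Group H] (K : Subgroup H) (r : ℕ)
    (h : IsPTorus p K r) : IsPTorus p (wreathBasePow p K) (p * r) := by
  obtain ⟨e⟩ := h
  haveI : NeZero p := ⟨hp⟩
  have e1 : (Subgroup.pi (Set.univ : Set (ZMod p)) fun _ => K) ≃* wreathBasePow p K :=
    Subgroup.equivMapOfInjective _ _ SemidirectProduct.inl_injective
  let e2 : (Subgroup.pi (Set.univ : Set (ZMod p)) fun _ => K) ≃* (ZMod p → K) :=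
    { toFun := fun x i => ⟨x.1 i, x.2 i trivial⟩
      invFun := fun y => ⟨fun i => (y i).1, fun i _ => (y i).2⟩
      left_inv := fun _ => rfl
      right_inv := fun _ => rfl
      map_mul' := fun _ _ => rfl }
  have e3 : (ZMod p → K) ≃* (ZMod p → Fin r → Multiplicative (ZMod p)) :=
    MulEquiv.piCongrRight fun _ => e
  let q : ZMod p × Fin r ≃ Fin (p * r) :=
    (Equiv.prodCongr (ZMod.finEquiv p).symm.toEquiv (Equiv.refl _)).trans finProdFinEquiv
  let e4 : (ZMod p → Fin r → Multiplicative (ZMod p)) ≃* (Fin (p * r) → Multiplicative (ZMod p)) :=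
    { toFun := fun x j => x (q.symm j).1 (q.symm j).2
      invFun := fun y a b => y (q (a, b))
      left_inv := fun x => by funext a b; simp
      right_inv := fun y => by funext j; simp
      map_mul' := fun _ _ => rfl }
  exact ⟨((e1.symm.trans e2).trans e3).trans e4⟩

theorem EW_torus (p : ℕ) (hp : p ≠ 0) (n : ℕ) : IsPTorus p (EW p (n + 1)) (p ^ n) := by
  induction n with
  | zero =>
    let e1 : (⊤ : Subgroup (Multiplicative (ZMod p))) ≃* Multiplicative (ZMod p) :=
      Subgroup.topEquiv
    let e2 : Multiplicative (ZMod p) ≃* (Fin (p ^ 0) → Multiplicative (ZMod p)) :=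
      { toFun := fun x _ => x
        invFun := fun y => y ⟨0, by simp⟩
        left_inv := fun _ => rfl
        right_inv := fun y => by
          funext ⟨j, hj⟩
          have : j = 0 := by simpa using hj
          subst this
          rfl
        map_mul' := fun _ _ => rfl }
    exact ⟨e1.trans e2⟩
  | succ n ih =>
    rw [pow_succ']
    exact wreathBasePow_torus p hp (H := W p (n + 1)) (EW p (n + 1)) (p ^ n) ih

theorem EW_ker (p n : ℕ) :
    ∃ f : W p (n + 2) →* W p (n + 1), Function.Surjective f ∧ f.ker = EW p (n + 2) := by
  induction n with
  | zero =>
    exact ⟨(SemidirectProduct.rightHom : WreathZp p (W p 1) →* Multiplicative (ZMod p)),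
      SemidirectProduct.rightHom_surjective, wreathRight_ker p (W p 1)⟩
  | succ n ih =>
    obtain ⟨f, hf, hk⟩ := ih
    obtain ⟨g, hg, hgk⟩ := wreathMap_exists p f hf
    rw [hk] at hgk
    exact ⟨g, hg, hgk⟩

/-- for `p ≥ 5` prime and `n ≥ 2`, `E(n)` is normal in `W(n)`, is
elementary abelian of rank `p^(n-1)` (isomorphic to `(ZMod p)^(p^(n-1))`), and the
quotient `W(n)/E(n)` is isomorphic to `W(n-1)` (equivalently, there is a surjective
homomorphism `W(n) →* W(n-1)` with kernel `E(n)`). -/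
theorem stmt6 (p n : ℕ) (hp : p.Prime) (hp5 : 5 ≤ p) (hn : 2 ≤ n) :
    (EW p n).Normal ∧
    IsPTorus p (EW p n) (p ^ (n - 1)) ∧
    ∃ f : W p n →* W p (n - 1), Function.Surjective f ∧ f.ker = EW p n := by
  obtain ⟨m, rfl⟩ := Nat.exists_eq_add_of_le' hn
  obtain ⟨f, hf, hk⟩ := EW_ker p m
  refine ⟨?_, EW_torus p hp.ne_zero (m + 1), f, hf, hk⟩
  rw [← hk]
  exact f.normal_ker
end

section
/- Let k be a field, j a natural number, P = k[x_1, …, x_j] the polynomial ring (MvPolynomial over Fin j), and N a commutative k-algebra that is finite-dimensional as a k-vector space, is local with maximal ideal m, and has residue field k (i.e. there is a surjective k-algebra homomorphism ε : N → k with kernel m). Let A = P ⊗_k N. Then A has exactly one associated prime as a module over itself, namely the kernel of the ring homomorphism id ⊗ ε : P ⊗_k N → P ⊗_k k ≅ P. That is, associatedPrimes A A = { ker(id ⊗ ε) }. -/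
set_option synthInstance.maxHeartbeats 400000

open scoped TensorProduct

theorem stmt9_nilp (k : Type) [Field k] (P : Type) [CommRing P] [Algebra k P]
    (N : Type) [CommRing N] [Algebra k N] [FiniteDimensional k N] [IsLocalRing N]
    (ε : N →ₐ[k] k)
    (hker : RingHom.ker (ε : N →+* k) = IsLocalRing.maximalIdeal N)
    (f : P ⊗[k] N →ₐ[k] P) (hf : ∀ p n, f (p ⊗ₜ n) = p * algebraMap k P (ε n))
    (t : P ⊗[k] N) : IsNilpotent (t - f t ⊗ₜ[k] (1 : N)) := by
  have : IsArtinianRing N := IsArtinianRing.of_finite k N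
  induction t using TensorProduct.induction_on with
  | zero => simp
  | add x y hx hy =>
    have : x + y - f (x + y) ⊗ₜ[k] (1 : N) = (x - f x ⊗ₜ[k] (1 : N)) + (y - f y ⊗ₜ[k] (1 : N)) := by
      rw [map_add, TensorProduct.add_tmul]; ring
    rw [this]
    exact (Commute.all _ _).isNilpotent_add hx hy
  | tmul p n =>
    have hm : n - algebraMap k N (ε n) ∈ IsLocalRing.maximalIdeal N := by
      rw [← hker, RingHom.mem_ker]; simp
    have hn : IsNilpotent (n - algebraMap k N (ε n)) := by
      have h := IsArtinianRing.isNilpotent_jacobson_bot (R := N)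
      rw [IsLocalRing.jacobson_eq_maximalIdeal ⊥ bot_ne_top] at h
      obtain ⟨m, hm'⟩ := h
      refine ⟨m, ?_⟩
      have := Ideal.pow_mem_pow hm m
      rw [hm'] at this
      simpa using this
    have : p ⊗ₜ[k] n - f (p ⊗ₜ n) ⊗ₜ[k] (1 : N) = p ⊗ₜ[k] (n - algebraMap k N (ε n)) := by
      rw [hf, TensorProduct.tmul_sub, mul_comm, ← Algebra.smul_def, TensorProduct.smul_tmul,
        Algebra.algebraMap_eq_smul_one]
    rw [this]
    obtain ⟨m, hm'⟩ := hn
    exact ⟨m, by rw [Algebra.TensorProduct.tmul_pow, hm', TensorProduct.tmul_zero]⟩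

theorem stmt9_reg (k : Type) [Field k] (P : Type) [CommRing P] [IsDomain P] [Algebra k P]
    (N : Type) [CommRing N] [Algebra k N] (p : P) (hp : p ≠ 0) (x : P ⊗[k] N)
    (h : p ⊗ₜ[k] (1 : N) * x = 0) : x = 0 := by
  have : p • x = 0 := by rw [← h, Algebra.smul_def]; rfl
  exact (smul_eq_zero.mp this).resolve_left hp

/-- let `P = k[x_1,…,x_j]` and let `N` be a finite-dimensional local
commutative `k`-algebra with residue field `k`, witnessed by a surjective `k`-algebra
map `ε : N → k` whose kernel is the maximal ideal.  Then `A = P ⊗[k] N` has exactly one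
associated prime as a module over itself, namely the kernel of `id ⊗ ε : P ⊗[k] N → P`. -/
theorem stmt9 (k : Type) [Field k] (j : ℕ)
    (N : Type) [CommRing N] [Algebra k N] [FiniteDimensional k N] [IsLocalRing N]
    (ε : N →ₐ[k] k) (hsurj : Function.Surjective ε)
    (hker : RingHom.ker (ε : N →+* k) = IsLocalRing.maximalIdeal N) :
    associatedPrimes (MvPolynomial (Fin j) k ⊗[k] N) (MvPolynomial (Fin j) k ⊗[k] N) =
      {RingHom.ker ((Algebra.TensorProduct.lift
          (AlgHom.id k (MvPolynomial (Fin j) k))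
          ((Algebra.ofId k (MvPolynomial (Fin j) k)).comp ε)
          (fun x y => Commute.all _ _)).toRingHom)} := by
  set f : MvPolynomial (Fin j) k ⊗[k] N →ₐ[k] MvPolynomial (Fin j) k :=
    Algebra.TensorProduct.lift
          (AlgHom.id k (MvPolynomial (Fin j) k))
          ((Algebra.ofId k (MvPolynomial (Fin j) k)).comp ε)
          (fun x y => Commute.all _ _) with hfdef
  have hf : ∀ p n, f (p ⊗ₜ n) = p * algebraMap k (MvPolynomial (Fin j) k) (ε n) := by
    intro p n
    simp [hfdef, Algebra.ofId_apply]
  have hnil := stmt9_nilp k (MvPolynomial (Fin j) k) N ε hker f hf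
  have hmem : ∀ t, t ∈ RingHom.ker f.toRingHom ↔ f t = 0 := fun t => Iff.rfl
  have hK : ∀ t, f t = 0 → IsNilpotent t := by
    intro t ht
    have := hnil t
    rwa [ht, TensorProduct.zero_tmul, sub_zero] at this
  have hK' : ∀ t, IsNilpotent t → f t = 0 := fun t ht => (ht.map f).eq_zero
  have hreg : ∀ r x, r * x = 0 → x ≠ 0 → f r = 0 := by
    intro r x hrx hx
    by_contra hr
    obtain ⟨m, hm⟩ := hnil r
    apply hx
    have key : ∀ i : ℕ, (f r ^ i) ⊗ₜ[k] (1 : N) * x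
        = (-1) ^ i * (r - f r ⊗ₜ[k] (1 : N)) ^ i * x := by
      intro i
      have h1 : (f r ^ i) ⊗ₜ[k] (1 : N) = (f r ⊗ₜ[k] (1 : N)) ^ i := by
        rw [Algebra.TensorProduct.tmul_pow, one_pow]
      rw [h1]
      clear h1
      induction i with
      | zero => simp
      | succ i ih =>
        rw [pow_succ', mul_assoc, ih]
        linear_combination (-1) ^ i * (r - f r ⊗ₜ[k] (1 : N)) ^ i * hrx
    have := key m
    rw [hm, mul_zero, zero_mul] at this
    exact stmt9_reg k _ N _ (pow_ne_zero m hr) x this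
  have hprime : (RingHom.ker f.toRingHom).IsPrime := RingHom.ker_isPrime _
  ext I
  rw [Set.mem_singleton_iff]
  constructor
  · rintro ⟨hI, x, hx⟩
    have hx0 : x ≠ 0 := by
      rintro rfl
      apply hI.ne_top
      rw [hx, Ideal.eq_top_iff_one]
      exact ⟨1, by simp [Submodule.mem_colon_singleton]⟩
    ext t
    rw [hmem]
    constructor
    · intro ht
      rw [hx] at ht
      obtain ⟨n, hn⟩ := ht
      rw [Submodule.mem_colon_singleton, Submodule.mem_bot, smul_eq_mul] at hn
      have := hreg _ _ hn hx0
      rw [map_pow] at this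
      exact eq_zero_of_pow_eq_zero this
    · intro ht
      obtain ⟨n, hn⟩ := hK t ht
      exact hI.mem_of_pow_mem n (by rw [hn]; exact I.zero_mem)
  · rintro rfl
    refine ⟨hprime, 1, ?_⟩
    ext t
    rw [hmem]
    have : t ∈ (Submodule.colon (⊥ : Submodule (MvPolynomial (Fin j) k ⊗[k] N)
        (MvPolynomial (Fin j) k ⊗[k] N)) {1}).radical ↔ IsNilpotent t := by
      refine exists_congr fun n => ?_
      rw [Submodule.mem_colon_singleton, Submodule.mem_bot, smul_eq_mul, mul_one]
    rw [this]
    exact ⟨hK t, hK' t⟩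
end

section
/- Let R be a commutative Noetherian ring and L a finitely generated R-module admitting a finite filtration by submodules 0 = F_m ⊆ F_{m−1} ⊆ … ⊆ F_1 ⊆ F_0 = L such that each quotient F_j/F_{j+1} is isomorphic as an R-module to a finite direct sum of modules A_{j,1}, …, A_{j,l_j}, where each A_{j,k} is a commutative Noetherian ring equipped with a ring homomorphism φ_{j,k} : R → A_{j,k} through which its R-module structure is defined, and each A_{j,k} has exactly one associated prime q_{j,k} as a module over itself. Then every associated prime of L over R is of the form φ_{j,k}^{-1}(q_{j,k}) for some j and k. -/
lemma aux_ring {R A : Type} [CommRing R] [IsNoetherianRing R] [CommRing A] [IsNoetherianRing A]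
    [Module R A] (φ : R →+* A) (hsmul : ∀ (r : R) (a : A), r • a = φ r * a) (q : Ideal A)
    (hq : associatedPrimes A A = {q}) (p : Ideal R) (hp : p.IsPrime) (a : A)
    (ha : ∀ r, r ∈ p ↔ r • a = 0) : p = Ideal.comap φ q := by
  have ha0 : a ≠ 0 := by
    rintro rfl
    exact hp.ne_top ((Ideal.eq_top_iff_one _).2 ((ha 1).2 (smul_zero _)))
  ext r
  rw [Ideal.mem_comap]
  constructor
  · intro hr
    have h1 := (ha r).1 hr
    rw [hsmul] at h1
    have h2 := biUnion_associatedPrimes_eq_zero_divisors A A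
    rw [hq] at h2
    have h3 : φ r ∈ { r : A | ∃ x : A, x ≠ 0 ∧ r • x = 0 } := ⟨a, ha0, h1⟩
    rw [← h2] at h3
    simpa using h3
  · intro hr
    have h4 : φ r ∈ nilradical A := by
      rw [nilradical, ← Ideal.sInf_minimalPrimes, Submodule.mem_sInf]
      intro P hP
      have h5 := Module.associatedPrimes.minimalPrimes_annihilator_subset_associatedPrimes A A
      rw [Module.annihilator_eq_bot.2 inferInstance, hq] at h5
      have h6 : P = q := h5 hP
      rwa [h6]
    obtain ⟨n, hn⟩ := h4
    refine hp.mem_of_pow_mem n ((ha _).2 ?_)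
    rw [hsmul, map_pow, hn, zero_mul]

lemma aux_sum {R : Type} [CommRing R] {n : ℕ} (A : Fin n → Type)
    [∀ k, AddCommGroup (A k)] [∀ k, Module R (A k)] (p : Ideal R) (hp : p.IsPrime)
    (x : DirectSum (Fin n) A) (hx : ∀ r, r ∈ p ↔ r • x = 0) :
    ∃ k, ∀ r, r ∈ p ↔ r • x k = 0 := by
  have hle : ∀ k r, r ∈ p → r • x k = 0 := by
    intro k r hr
    rw [← DirectSum.smul_apply, (hx r).1 hr, DirectSum.zero_apply]
  by_contra! h
  have h' : ∀ k, ∃ r, r ∉ p ∧ r • x k = 0 := by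
    intro k
    obtain ⟨r, hr⟩ := h k
    rcases hr with hr | hr
    · exact absurd (hle k r hr.1) hr.2
    · exact ⟨r, hr⟩
  choose r hr hrx using h'
  have h1 : ∏ k, r k ∈ p := by
    rw [hx]
    refine DFinsupp.ext fun k => ?_
    change ((∏ k, r k) • x) k = 0
    rw [DirectSum.smul_apply, ← Finset.prod_erase_mul _ _ (Finset.mem_univ k), mul_smul, hrx,
      smul_zero]
  obtain ⟨k, -, hk⟩ := hp.prod_mem_iff.1 h1
  exact hr k hk

/-- let `R` be a commutative Noetherian ring and `L` a finitely generated
`R`-module with a finite filtration `0 = F m ⊆ ⋯ ⊆ F 0 = L` whose subquotients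
`F j / F (j+1)` are direct sums of modules `A j k`, where each `A j k` is a commutative
Noetherian ring whose `R`-module structure comes from a ring map `φ j k : R → A j k`,
and each `A j k` has exactly one associated prime `q j k` over itself.  Then every
associated prime of `L` over `R` is of the form `(φ j k)⁻¹ (q j k)`. -/
theorem stmt10 {R : Type} [CommRing R] [IsNoetherianRing R]
    {L : Type} [AddCommGroup L] [Module R L] [Module.Finite R L]
    (m : ℕ) (F : ℕ → Submodule R L)
    (hF0 : F 0 = ⊤) (hFm : F m = ⊥) (hchain : ∀ j, F (j + 1) ≤ F j)
    (l : ℕ → ℕ) (A : (j : ℕ) → Fin (l j) → Type)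
    [∀ j k, CommRing (A j k)] [∀ j k, IsNoetherianRing (A j k)]
    [∀ j k, Module R (A j k)]
    (φ : (j : ℕ) → (k : Fin (l j)) → R →+* A j k)
    (hsmul : ∀ j k (r : R) (a : A j k), r • a = φ j k r * a)
    (q : (j : ℕ) → (k : Fin (l j)) → Ideal (A j k))
    (hq : ∀ j k, associatedPrimes (A j k) (A j k) = {q j k})
    (hiso : ∀ j, j < m → Nonempty
      ((↥(F j) ⧸ (Submodule.comap (F j).subtype (F (j + 1)))) ≃ₗ[R]
        DirectSum (Fin (l j)) fun k => A j k)) :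
    ∀ 𝔭 ∈ associatedPrimes R L, ∃ j, j < m ∧ ∃ k, 𝔭 = Ideal.comap (φ j k) (q j k) := by
  have key : ∀ i j, j + i = m → ∀ 𝔭 ∈ associatedPrimes R (F j),
      ∃ j, j < m ∧ ∃ k, 𝔭 = Ideal.comap (φ j k) (q j k) := by
    intro i
    induction i with
    | zero =>
      intro j hj 𝔭 hp
      have hj' : F j = ⊥ := by rw [← hFm, ← hj, add_zero]
      rw [hj', associatedPrimes.eq_empty_of_subsingleton] at hp
      exact hp.elim
    | succ i ih =>
      intro j hj 𝔭 hp
      have hex : Function.Exact (Submodule.inclusion (hchain j))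
          (Submodule.comap (F j).subtype (F (j + 1))).mkQ := by
        rw [LinearMap.exact_iff, Submodule.ker_mkQ, Submodule.range_inclusion]
      rcases associatedPrimes.subset_union_of_exact
        (Submodule.inclusion_injective (hchain j)) hex hp with h | h
      · exact ih (j + 1) (by omega) 𝔭 h
      · have hjm : j < m := by omega
        obtain ⟨e⟩ := hiso j hjm
        replace h := associatedPrimes.subset_of_injective (f := e.toLinearMap) e.injective h
        obtain ⟨hpp, x, hx⟩ := isAssociatedPrime_iff.1 h
        obtain ⟨k, hk⟩ := aux_sum (A j) 𝔭 hpp x (by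
          intro r
          rw [hx, Submodule.mem_colon_singleton, Submodule.mem_bot])
        exact ⟨j, hjm, k, aux_ring (φ j k) (hsmul j k) (q j k) (hq j k) 𝔭 hpp (x k) hk⟩
  intro 𝔭 hp
  refine key m 0 (zero_add m) 𝔭 ?_
  rw [hF0]
  exact associatedPrimes.subset_of_injective
    (f := (Submodule.topEquiv : (⊤ : Submodule R L) ≃ₗ[R] L).symm.toLinearMap)
    (Submodule.topEquiv : (⊤ : Submodule R L) ≃ₗ[R] L).symm.injective hp
end

section
/- Let k be a field, R a commutative Noetherian k-algebra, and L a finitely generated R-module admitting a finite filtration by submodules 0 = F_m ⊆ F_{m−1} ⊆ … ⊆ F_1 ⊆ F_0 = L such that for each j, the quotient F_j/F_{j+1} is isomorphic as an R-module to a finite direct sum of modules of the form k[x_1, …, x_j] ⊗_k N (MvPolynomial over Fin j tensored with a finite-dimensional commutative k-algebra N), where the R-module structure on each summand is given through a k-algebra homomorphism from R making the summand a finitely generated R-module. Then for every s, the Krull dimension of R / Ann_R(L/F_s) is at most s − 1; in other words, the Krull dimension of the R-module L/F_s is strictly less than s. -/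
set_option synthInstance.maxHeartbeats 400000

open scoped TensorProduct


lemma aux_series {R S : Type} [CommRing R] [CommRing S] (f : R →+* S) (hf : f.IsIntegral)
    (n : ℕ) (hS : ringKrullDim S ≤ n) (l : LTSeries (PrimeSpectrum R))
    (hl : RingHom.ker f ≤ l.head.asIdeal) : l.length ≤ n := by
  let := f.toAlgebra
  have : Algebra.IsIntegral R S := ⟨hf⟩
  obtain ⟨Q, -, hQ, hQ'⟩ := Ideal.exists_ideal_over_prime_of_isIntegral (S := S) l.head.asIdeal ⊥
    (by rw [← RingHom.ker_eq_comap_bot]; exact hl)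
  have : Q.LiesOver l.head.asIdeal := ⟨hQ'.symm⟩
  obtain ⟨M, hM, -⟩ := Ideal.exists_ltSeries_of_hasGoingUp (S := S) l Q
  have := (Order.LTSeries.length_le_krullDim M).trans hS
  rw [hM] at this
  exact_mod_cast this

lemma aux_dim (K : Type) [Field K] (j : ℕ) (N : Type) [CommRing N] [Algebra K N]
    [FiniteDimensional K N] : ringKrullDim (MvPolynomial (Fin j) K ⊗[K] N) ≤ j := by
  have h : ringKrullDim (MvPolynomial (Fin j) K) = j := by
    rw [MvPolynomial.ringKrullDim_of_isNoetherianRing]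
    simp
  rw [← h]
  refine Order.krullDim_le_of_strictMono
    (PrimeSpectrum.comap (algebraMap (MvPolynomial (Fin j) K) (MvPolynomial (Fin j) K ⊗[K] N))) ?_
  intro p q hpq
  have : Algebra.IsIntegral (MvPolynomial (Fin j) K) (MvPolynomial (Fin j) K ⊗[K] N) :=
    Algebra.IsIntegral.of_finite _ _
  exact Ideal.IsIntegral.comap_lt_comap (R := MvPolynomial (Fin j) K) (I := p.asIdeal)
    (J := q.asIdeal) hpq

lemma aux_int {R S : Type} [CommRing R] [CommRing S] [inst : Module R S] (f : R →+* S)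
    (hsmul : ∀ (r : R) (x : S), r • x = f r * x) (hfin : Module.Finite R S) : f.IsIntegral := by
  apply RingHom.Finite.to_isIntegral
  have h : inst = f.toAlgebra.toModule := by
    apply Module.ext
    ext r x
    exact hsmul r x
  subst h
  exact hfin

/-- let `K` be a field, `R` a commutative Noetherian `K`-algebra, and `L` a
finitely generated `R`-module with a finite filtration `0 = F m ⊆ ⋯ ⊆ F 0 = L` whose
subquotients `F j / F (j+1)` are direct sums of modules of the form
`K[x_1,…,x_j] ⊗[K] N`, with `N` a finite-dimensional commutative `K`-algebra, the
`R`-module structure on each summand being given through a `K`-algebra map from `R`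
making it a finitely generated `R`-module.  Then for every `s` the Krull dimension of
the `R`-module `L / F s`, i.e. of the ring `R / Ann_R (L / F s)`, is strictly less
than `s`. -/
theorem stmt11 (K : Type) [Field K]
    {R : Type} [CommRing R] [Algebra K R] [IsNoetherianRing R]
    {L : Type} [AddCommGroup L] [Module R L] [Module.Finite R L]
    (m : ℕ) (F : ℕ → Submodule R L)
    (hF0 : F 0 = ⊤) (hFm : F m = ⊥) (hchain : ∀ j, F (j + 1) ≤ F j)
    (l : ℕ → ℕ) (N : (j : ℕ) → Fin (l j) → Type)
    [∀ j k, CommRing (N j k)] [∀ j k, Algebra K (N j k)]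
    [∀ j k, FiniteDimensional K (N j k)]
    [∀ j k, Module R (MvPolynomial (Fin j) K ⊗[K] N j k)]
    (ψ : (j : ℕ) → (k : Fin (l j)) → R →ₐ[K] (MvPolynomial (Fin j) K ⊗[K] N j k))
    (hsmul : ∀ j k (r : R) (x : MvPolynomial (Fin j) K ⊗[K] N j k),
      r • x = ψ j k r * x)
    (hfin : ∀ j k, Module.Finite R (MvPolynomial (Fin j) K ⊗[K] N j k))
    (hiso : ∀ j, j < m → Nonempty
      ((↥(F j) ⧸ (Submodule.comap (F j).subtype (F (j + 1)))) ≃ₗ[R]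
        DirectSum (Fin (l j)) fun k => MvPolynomial (Fin j) K ⊗[K] N j k)) :
    ∀ s : ℕ, ringKrullDim (R ⧸ Module.annihilator R (L ⧸ F s)) < (s : WithBot (WithTop ℕ)) := by
  have key : ∀ s, s ≤ m → ∀ p : Ideal R, p.IsPrime → Module.annihilator R (L ⧸ F s) ≤ p →
      ∃ j, j < s ∧ ∃ k, RingHom.ker (ψ j k) ≤ p := by
    intro s
    induction s with
    | zero =>
      intro _ p hp h
      exfalso
      apply hp.ne_top
      rw [eq_top_iff]
      refine le_trans ?_ h
      intro r _
      rw [Module.mem_annihilator]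
      intro x
      obtain ⟨y, rfl⟩ := Submodule.Quotient.mk_surjective _ x
      rw [← Submodule.Quotient.mk_smul, Submodule.Quotient.mk_eq_zero, hF0]
      trivial
    | succ s ih =>
      intro hs p hp h
      obtain ⟨e⟩ := hiso s (by omega)
      have hle : Module.annihilator R (L ⧸ F s) * ∏ k, RingHom.ker (ψ s k) ≤
          Module.annihilator R (L ⧸ F (s + 1)) := by
        rw [Ideal.mul_le]
        intro a ha b hb
        rw [Module.mem_annihilator] at ha ⊢
        intro x
        obtain ⟨y, rfl⟩ := Submodule.Quotient.mk_surjective _ x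
        have hy := ha (Submodule.Quotient.mk y)
        rw [← Submodule.Quotient.mk_smul, Submodule.Quotient.mk_eq_zero] at hy
        rw [← Submodule.Quotient.mk_smul, Submodule.Quotient.mk_eq_zero]
        have hz : b • (Submodule.Quotient.mk ⟨a • y, hy⟩ :
            (↥(F s) ⧸ (Submodule.comap (F s).subtype (F (s + 1))))) = 0 := by
          apply e.injective
          rw [map_smul, map_zero]
          refine DFinsupp.ext fun k => ?_
          have hbk : b ∈ RingHom.ker (ψ s k) :=
            (Ideal.prod_le_inf.trans (Finset.inf_le (Finset.mem_univ k))) hb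
          rw [RingHom.mem_ker] at hbk
          refine (DirectSum.smul_apply _ _ _).trans ?_
          rw [hsmul, hbk, zero_mul]
          rfl
        rw [← Submodule.Quotient.mk_smul, Submodule.Quotient.mk_eq_zero] at hz
        have hz' : b • a • y ∈ F (s + 1) := hz
        rwa [mul_comm, mul_smul]
      rcases hp.mul_le.mp (hle.trans h) with h1 | h1
      · obtain ⟨j, hj, k, hk⟩ := ih (by omega) p hp h1
        exact ⟨j, by omega, k, hk⟩
      · obtain ⟨k, -, hk⟩ := hp.prod_le.mp h1
        exact ⟨s, by omega, k, hk⟩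
  have main : ∀ s, s ≤ m →
      ringKrullDim (R ⧸ Module.annihilator R (L ⧸ F s)) < (s : WithBot (WithTop ℕ)) := by
    intro s hs
    rw [ringKrullDim_quotient]
    refine Order.krullDim_lt_coe_iff.mpr ?_
    intro t
    obtain ⟨j, hj, k, hk⟩ := key s hs t.head.1.asIdeal t.head.1.isPrime t.head.2
    refine lt_of_le_of_lt ?_ hj
    exact aux_series (ψ j k).toRingHom (aux_int (ψ j k).toRingHom (hsmul j k) (hfin j k)) j
      (aux_dim K j (N j k)) (t.map Subtype.val (fun _ _ h => h)) hk
  intro s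
  rcases le_total s m with h | h
  · exact main s h
  · have hb : F s = F m := by
      have : Antitone F := antitone_nat_of_succ_le hchain
      rw [hFm]
      exact le_bot_iff.mp (hFm ▸ this h)
    rw [hb]
    exact (main m le_rfl).trans_le (Nat.mono_cast (α := WithBot ℕ∞) h)
end

section
/- Let R be a commutative Noetherian local ring. Let (T_i)_{i ∈ ι} be a finite family where each T_i is a commutative ring equipped with a ring homomorphism r_i : R → T_i (so T_i is an R-module via r_i), together with an R-module homomorphism s_i : T_i → R. Let I be the ideal of R generated by the union of the images of the maps s_i. If the Krull dimension of R/I is strictly less than the depth of R (as a module over itself with respect to its maximal ideal), then the ring homomorphism R → ∏_i T_i whose components are the r_i is injective. -/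
open RingTheory.Sequence Pointwise in
theorem length_le_dim_of_killed {R : Type} [CommRing R] [IsNoetherianRing R] [IsLocalRing R]
    (rs : List R) : ∀ (M : Type) [AddCommGroup M] [Module R M] [Module.Finite R M]
    (_ : ∀ x ∈ rs, x ∈ IsLocalRing.maximalIdeal R) (_ : IsWeaklyRegular M rs)
    (I : Ideal R) (x : M) (_ : x ≠ 0) (_ : ∀ a ∈ I, a • x = 0),
    ((rs.length : ℕ) : WithBot ℕ∞) ≤ ringKrullDim (R ⧸ I) := by
  induction rs with
  | nil =>
    intro M _ _ _ _ _ I x hx hI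
    have : Nontrivial (R ⧸ I) := by
      rw [Ideal.Quotient.nontrivial_iff]
      rintro rfl
      exact hx (by simpa using hI 1 trivial)
    simpa using ringKrullDim_nonneg_of_nontrivial (R := R ⧸ I)
  | cons a rs ih =>
    intro M _ _ _ hmem hreg I x hx hI
    rw [isWeaklyRegular_cons_iff] at hreg
    obtain ⟨ha, hreg⟩ := hreg
    obtain ⟨P, hP, hle⟩ := exists_le_isAssociatedPrime_of_isNoetherianRing R x hx
    obtain ⟨hPp, y, hy⟩ := isAssociatedPrime_iff.mp hP
    have hPy : ∀ b, b ∈ P ↔ b • y = 0 := by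
      intro b; rw [hy, Submodule.mem_colon_singleton, Submodule.mem_bot]
    have hIP : I ≤ P := fun b hb => hle (by
      rw [Submodule.mem_colon_singleton, Submodule.mem_bot]; exact hI b hb)
    have hy0 : y ≠ 0 := by
      rintro rfl
      exact hPp.ne_top ((Ideal.eq_top_iff_one _).mpr ((hPy 1).mpr (by simp)))
    have haP : a ∉ P := fun h => hy0 (ha (by simpa using (hPy a).mp h))
    -- Nakayama step
    let N : Submodule R M := Submodule.torsionBySet R M (P : Set R)
    have hN : ∀ z, z ∈ N ↔ ∀ b ∈ P, b • z = 0 := by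
      intro z; simp [N, Submodule.mem_torsionBySet_iff]
    have hex : ∃ z ∈ N, z ∉ a • (⊤ : Submodule R M) := by
      by_contra! hcon
      have hbot : N = ⊥ := by
        apply Submodule.eq_bot_of_le_smul_of_le_jacobson_bot (IsLocalRing.maximalIdeal R) N
          (IsNoetherian.noetherian N)
        · intro z hz
          obtain ⟨w, -, rfl⟩ := (Submodule.mem_smul_pointwise_iff_exists _ _ _).mp (hcon z hz)
          refine Submodule.smul_mem_smul (hmem a (by simp)) ((hN w).mpr fun b hb => ha ?_)
          have := (hN _).mp hz b hb
          simpa [smul_comm a b] using this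
        · exact IsLocalRing.maximalIdeal_le_jacobson _
      have : y ∈ N := (hN y).mpr fun b hb => (hPy b).mp hb
      rw [hbot] at this
      exact hy0 (by simpa using this)
    obtain ⟨z, hzN, hz⟩ := hex
    have key := ih (QuotSMulTop a M) (fun x hx => hmem x (by simp [hx])) hreg
      (P ⊔ Ideal.span {a}) (Submodule.Quotient.mk z)
      (by rwa [Ne, Submodule.Quotient.mk_eq_zero]) (by
        have : P ⊔ Ideal.span {a} ≤
            (⊥ : Submodule R (QuotSMulTop a M)).colon {Submodule.Quotient.mk z} := by
          refine sup_le (fun b hb => ?_) ?_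
          · rw [Submodule.mem_colon_singleton, Submodule.mem_bot, ← Submodule.Quotient.mk_smul,
              (hN z).mp hzN b hb, Submodule.Quotient.mk_zero]
          · rw [Ideal.span_singleton_le_iff_mem, Submodule.mem_colon_singleton,
              Submodule.mem_bot, ← Submodule.Quotient.mk_smul, Submodule.Quotient.mk_eq_zero]
            exact Submodule.smul_mem_pointwise_smul _ _ _ trivial
        intro b hb
        simpa [Submodule.mem_colon_singleton] using this hb)
    have h1 : ringKrullDim (R ⧸ (P ⊔ Ideal.span {a})) + 1 ≤ ringKrullDim (R ⧸ P) := by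
      refine ringKrullDim_succ_le_of_surjective
        (Ideal.Quotient.factor (le_sup_left : P ≤ P ⊔ Ideal.span {a}))
        (Ideal.Quotient.factor_surjective _) (r := Ideal.Quotient.mk P a) ?_ ?_
      · rw [mem_nonZeroDivisors_iff_ne_zero, Ne, Ideal.Quotient.eq_zero_iff_mem]
        exact haP
      · rw [Ideal.Quotient.factor_mk, Ideal.Quotient.eq_zero_iff_mem]
        exact Ideal.mem_sup_right (Ideal.mem_span_singleton_self a)
    have h2 : ringKrullDim (R ⧸ P) ≤ ringKrullDim (R ⧸ I) :=
      ringKrullDim_le_of_surjective (Ideal.Quotient.factor hIP)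
        (Ideal.Quotient.factor_surjective _)
    refine le_trans ?_ (h1.trans h2)
    rw [List.length_cons, Nat.cast_add, Nat.cast_one]
    gcongr

/-- let `R` be a commutative Noetherian local ring and `(T i)` a finite
family of commutative rings with ring maps `r i : R → T i` (through which each `T i` is
an `R`-module) and `R`-linear maps `s i : T i → R`.  Let `I` be the ideal of `R`
generated by the images of the `s i`.  If the Krull dimension of `R / I` is strictly
less than the depth of `R` (i.e. there is an `R`-regular sequence in the maximal ideal
of length strictly bigger than `dim R / I`), then the ring map `R → ∏ i, T i` with
components `r i` is injective. -/
theorem stmt12 {R : Type} [CommRing R] [IsNoetherianRing R] [IsLocalRing R]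
    {ι : Type} [Finite ι]
    (T : ι → Type) [∀ i, CommRing (T i)] [∀ i, Module R (T i)]
    (r : (i : ι) → R →+* T i)
    (hsmul : ∀ i (x : R) (t : T i), x • t = r i x * t)
    (s : (i : ι) → T i →ₗ[R] R)
    (hdepth : ∃ d : ℕ,
      ringKrullDim (R ⧸ (⨆ i, LinearMap.range (s i) : Ideal R)) < (d : WithBot (WithTop ℕ)) ∧
      ∃ rs : List R, rs.length = d ∧ (∀ x ∈ rs, x ∈ IsLocalRing.maximalIdeal R) ∧
        RingTheory.Sequence.IsRegular R rs) :
    Function.Injective (Pi.ringHom r) := by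
  obtain ⟨d, hd, rs, rfl, hmem, hreg⟩ := hdepth
  rw [injective_iff_map_eq_zero]
  intro x hx
  by_contra hx0
  refine absurd hd (not_lt.mpr (length_le_dim_of_killed rs R hmem hreg.toIsWeaklyRegular _ x hx0 ?_))
  have hle : (⨆ i, LinearMap.range (s i) : Ideal R) ≤ (⊥ : Ideal R).colon {x} := by
    refine iSup_le fun i => ?_
    rintro _ ⟨t, rfl⟩
    have hri : r i x = 0 := congrFun hx i
    rw [Submodule.mem_colon_singleton, Submodule.mem_bot, smul_eq_mul, mul_comm, ← smul_eq_mul,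
      ← map_smul, hsmul, hri, zero_mul, map_zero]
  intro a ha
  simpa [Submodule.mem_colon_singleton] using hle ha
end

section
/- Let k be a field, n a natural number, and N a commutative k-algebra that is finite-dimensional as a k-vector space, is local with maximal ideal m_N, and has residue field k. Let A = k[x_1, …, x_n] ⊗_k N (MvPolynomial over Fin n tensored with N), and let 𝔪 be the kernel of the k-algebra homomorphism A → k sending every variable x_i to 0 and given on N by the residue map N → N/m_N ≅ k (so 𝔪 is the unique maximal ideal of A containing all variables and m_N). Then the local cohomology modules of A with respect to 𝔪 satisfy: H^i_𝔪(A) = 0 for all i ≠ n, and H^n_𝔪(A) ≠ 0. -/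
set_option synthInstance.maxHeartbeats 400000

open scoped TensorProduct

namespace LC

open CategoryTheory Limits Opposite

noncomputable section
section ExtCompare

variable {R : Type} [CommRing R] {X X' : ModuleCat.{0} R} (Y : ModuleCat.{0} R)

/-- the complex computing old Ext, in the opposite category -/
abbrev KK (P : ProjectiveResolution X) : ChainComplex (ModuleCat.{0} R)ᵒᵖ ℕ :=
  (((linearYoneda R (ModuleCat.{0} R)).obj Y).rightOp.mapHomologicalComplex _).obj P.complex

abbrev EE (n : ℕ) (X : ModuleCat.{0} R) : ModuleCat R :=
  ((_root_.Ext R (ModuleCat.{0} R) n).obj (op X)).obj Y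

abbrev FF : ModuleCat.{0} R ⥤ (ModuleCat.{0} R)ᵒᵖ :=
  ((linearYoneda R (ModuleCat.{0} R)).obj Y).rightOp

def jj (P : ProjectiveResolution X) (n : ℕ) :
    ((FF Y).leftDerived n).obj X ≅ (KK Y P).homology n :=
  P.isoLeftDerivedObj (FF Y) n

lemma jj_nat (P : ProjectiveResolution X) (P' : ProjectiveResolution X') (n : ℕ)
    (g : X' ⟶ X) (φ : ProjectiveResolution.Hom P' P g) :
    ((FF Y).leftDerived n).map g ≫ (jj Y P n).hom = (jj Y P' n).hom ≫
      HomologicalComplex.homologyMap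
        (((FF Y).mapHomologicalComplex (ComplexShape.down ℕ)).map φ.hom) n :=
  ProjectiveResolution.isoLeftDerivedObj_hom_naturality g P' P φ.hom
    (by simpa using φ.hom_f_zero_comp_π_f_zero) (FF Y) n

def qq (P : ProjectiveResolution X) (n : ℕ) : ((KK Y P).opcycles n).unop ⟶ EE Y n X :=
  ((jj Y P n).hom ≫ (KK Y P).homologyι n).unop

instance (P : ProjectiveResolution X) (n : ℕ) : Epi (qq Y P n) := by
  exact unop_epi_of_mono ((jj Y P n).hom ≫ (KK Y P).homologyι n)

def ii (P : ProjectiveResolution X) (n : ℕ) :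
    ((KK Y P).opcycles n).unop ⟶ ModuleCat.of R (P.complex.X n ⟶ Y) :=
  ((KK Y P).pOpcycles n).unop

lemma ii_d (P : ProjectiveResolution X) (n : ℕ) (z : ((KK Y P).opcycles n).unop) (m : ℕ) :
    P.complex.d m n ≫ (ii Y P n z : P.complex.X n ⟶ Y) = 0 := by
  have := (KK Y P).d_pOpcycles m n
  have h2 := congrArg (fun f => f.unop.hom z) this
  exact h2

lemma ii_surj (P : ProjectiveResolution X) (n : ℕ) (f : P.complex.X n ⟶ Y)
    (hf : P.complex.d (n+1) n ≫ f = 0) : ∃ z, ii Y P n z = f := by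
  have hS := ShortComplex.exact_of_g_is_cokernel
    (ShortComplex.mk ((KK Y P).d (n+1) n) ((KK Y P).pOpcycles n)
      ((KK Y P).d_pOpcycles (n+1) n))
    ((KK Y P).opcyclesIsCokernel (n+1) n (by simp))
  have h2 := hS.unop
  rw [ShortComplex.moduleCat_exact_iff] at h2
  exact h2 f hf

lemma qq_eq_zero_iff (P : ProjectiveResolution X) (n j : ℕ)
    (hj : (ComplexShape.down ℕ).next n = j) (z : ((KK Y P).opcycles n).unop) :
    qq Y P n z = 0 ↔ ∃ g : P.complex.X j ⟶ Y, P.complex.d n j ≫ g = ii Y P n z := by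
  have hS := ShortComplex.exact_of_f_is_kernel
    (ShortComplex.mk ((KK Y P).homologyι n) ((KK Y P).fromOpcycles n j) (by simp))
    ((KK Y P).homologyIsKernel n j hj)
  have h2 := hS.unop
  rw [ShortComplex.moduleCat_exact_iff] at h2
  have hinj : Function.Injective (ii Y P n) := by
    rw [← ModuleCat.mono_iff_injective]; exact unop_mono_of_epi ((KK Y P).pOpcycles n)
  have hfac : ∀ g : P.complex.X j ⟶ Y,
      ii Y P n (((KK Y P).fromOpcycles n j).unop.hom g) = P.complex.d n j ≫ g := by
    intro g
    have := (KK Y P).p_fromOpcycles n j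
    exact congrArg (fun f => f.unop.hom g) this
  have hq : qq Y P n z = 0 ↔ ((KK Y P).homologyι n).unop.hom z = 0 := by
    have h3 : Function.Injective ((jj Y P n).hom.unop) := by
      rw [← ModuleCat.mono_iff_injective]
      exact unop_mono_of_epi _
    constructor
    · intro h
      exact h3 (h.trans (map_zero (jj Y P n).hom.unop.hom).symm)
    · intro h
      exact (congrArg (jj Y P n).hom.unop.hom h).trans (map_zero (jj Y P n).hom.unop.hom)
  rw [hq]
  constructor
  · intro h
    obtain ⟨g, hg⟩ := h2 z h
    refine ⟨g, ?_⟩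
    exact (hfac g).symm.trans (congrArg (ii Y P n) hg)
  · rintro ⟨g, hg⟩
    rw [← hfac] at hg
    have := hinj hg
    rw [← this]
    have h5 := congrArg (fun f => f.unop.hom g) ((KK Y P).homologyι_comp_fromOpcycles n j)
    exact h5

lemma qq_naturality (P : ProjectiveResolution X) (P' : ProjectiveResolution X') (n : ℕ)
    (g : X' ⟶ X) (φ : ProjectiveResolution.Hom P' P g) (z : ((KK Y P).opcycles n).unop) :
    ∃ z', ((_root_.Ext R (ModuleCat.{0} R) n).map g.op).app Y (qq Y P n z) = qq Y P' n z' ∧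
      ii Y P' n z' = φ.hom.f n ≫ (ii Y P n z : P.complex.X n ⟶ Y) := by
  let F := FF Y
  have h1 := jj_nat Y P P' n g φ
  have h2 := HomologicalComplex.homologyι_naturality
    ((F.mapHomologicalComplex (ComplexShape.down ℕ)).map φ.hom) n
  have h3 := HomologicalComplex.p_opcyclesMap
    ((F.mapHomologicalComplex (ComplexShape.down ℕ)).map φ.hom) n
  refine ⟨(HomologicalComplex.opcyclesMap
    ((F.mapHomologicalComplex (ComplexShape.down ℕ)).map φ.hom) n).unop.hom z, ?_, ?_⟩
  · have h4 : (F.leftDerived n).map g ≫ (jj Y P n).hom ≫ (KK Y P).homologyι n =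
      (jj Y P' n).hom ≫ (KK Y P').homologyι n ≫ HomologicalComplex.opcyclesMap
        ((F.mapHomologicalComplex (ComplexShape.down ℕ)).map φ.hom) n := by
      rw [← Category.assoc, h1, Category.assoc]
      rw [← h2]
    exact congrArg (fun f => f.unop.hom z) h4
  · exact congrArg (fun f => f.unop.hom z) h3

open Abelian in
lemma extMk_eq_zero_iff' (P : ProjectiveResolution X) (n j : ℕ)
    (hj : (ComplexShape.down ℕ).next n = j) (f : P.complex.X n ⟶ Y)
    (hf : P.complex.d (n+1) n ≫ f = 0) :
    P.extMk f (n+1) rfl hf = 0 ↔ ∃ g : P.complex.X j ⟶ Y, P.complex.d n j ≫ g = f := by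
  cases n with
  | succ p =>
    obtain rfl : p = j := by rw [← hj]; simp
    exact P.extMk_eq_zero_iff f _ rfl hf p rfl
  | zero =>
    obtain rfl : 0 = j := by rw [← hj]; simp
    have hd : P.complex.d 0 0 = 0 := P.complex.shape _ _ (by simp)
    simp only [hd, zero_comp, exists_const]
    constructor
    · intro h
      rw [← P.extEquivCohomologyClass.apply_eq_iff_eq,
        ProjectiveResolution.extEquivCohomologyClass_extMk,
        ProjectiveResolution.extEquivCohomologyClass_zero,
        CochainComplex.HomComplex.CohomologyClass.mk_eq_zero_iff,
        CochainComplex.HomComplex.Cocycle.toSingleMk_mem_coboundaries_iff _ _ _ _ _ 1 (by simp)] at h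
      obtain ⟨g, hg⟩ := h
      have hz : IsZero (P.cochainComplex.X 1) := by
        exact CochainComplex.isZero_of_isStrictlyLE _ 0 1 (by simp)
      rw [hz.eq_of_src g 0, comp_zero] at hg
      exact ((cancel_epi _).1 (hg.symm.trans (comp_zero).symm)).symm
    · rintro rfl
      simp

open Abelian

lemma EE_subsingleton (n : ℕ) (h : Subsingleton (Abelian.Ext X Y n)) :
    Subsingleton (EE Y n X) := by
  let P := projectiveResolution X
  refine subsingleton_of_forall_eq 0 fun y => ?_
  obtain ⟨z, rfl⟩ := (ModuleCat.epi_iff_surjective (qq Y P n)).1 inferInstance y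
  rw [qq_eq_zero_iff Y P n _ rfl, ← extMk_eq_zero_iff' Y P n _ rfl _ (ii_d Y P n z _)]
  exact Subsingleton.elim _ _

lemma EE_nontrivial (n : ℕ) (h : Nontrivial (Abelian.Ext X Y n)) :
    Nontrivial (EE Y n X) := by
  let P := projectiveResolution X
  obtain ⟨a, ha⟩ := exists_ne (0 : Abelian.Ext X Y n)
  obtain ⟨f, hf, rfl⟩ := P.extMk_surjective a _ rfl
  obtain ⟨z, rfl⟩ := ii_surj Y P n f hf
  refine ⟨qq Y P n z, 0, fun h => ha ?_⟩
  rwa [qq_eq_zero_iff Y P n _ rfl, ← extMk_eq_zero_iff' Y P n _ rfl _ (ii_d Y P n z _)] at h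

lemma EE_map_injective (n : ℕ) (g : X' ⟶ X)
    (h : ∀ a : Abelian.Ext X Y n, (Ext.mk₀ g).comp a (zero_add n) = 0 → a = 0) :
    Function.Injective (((_root_.Ext R (ModuleCat.{0} R) n).map g.op).app Y) := by
  let P := projectiveResolution X
  let P' := projectiveResolution X'
  let φ : ProjectiveResolution.Hom P' P g := ⟨ProjectiveResolution.lift g P' P,
    ProjectiveResolution.lift_commutes_zero g P' P⟩
  rw [injective_iff_map_eq_zero]
  intro y hy
  obtain ⟨z, rfl⟩ := (ModuleCat.epi_iff_surjective (qq Y P n)).1 inferInstance y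
  obtain ⟨z', h1, h2⟩ := qq_naturality Y P P' n g φ z
  have hy' : qq Y P' n z' = 0 := h1.symm.trans hy
  rw [qq_eq_zero_iff Y P' n _ rfl, ← extMk_eq_zero_iff' Y P' n _ rfl _ (ii_d Y P' n z' _)] at hy'
  rw [qq_eq_zero_iff Y P n _ rfl, ← extMk_eq_zero_iff' Y P n _ rfl _ (ii_d Y P n z _)]
  apply h
  rw [ProjectiveResolution.mk₀_comp_extMk _ _ _ _ φ, ← hy']
  congr 1
  exact h2.symm

end ExtCompare

section Reg
open RingTheory.Sequence Abelian

lemma weaklyRegular_X_pow (k : Type) [CommRing k] (n t : ℕ) :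
    IsWeaklyRegular (MvPolynomial (Fin n) k)
      (List.ofFn fun i : Fin n => (MvPolynomial.X i : MvPolynomial (Fin n) k) ^ t) := by
  rw [isWeaklyRegular_iff]
  intro i hi
  have hin : i < n := by simpa using hi
  have hI : Ideal.ofList ((List.ofFn fun i : Fin n =>
      (MvPolynomial.X i : MvPolynomial (Fin n) k) ^ t).take i) =
      Ideal.span ((fun s => MvPolynomial.monomial s (1 : k)) ''
        {s | ∃ j : Fin n, j.1 < i ∧ s = Finsupp.single j t}) := by
    unfold Ideal.ofList
    congr 1
    ext p
    simp only [Set.mem_ofPred_eq, List.mem_take_iff_getElem, Set.mem_image]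
    constructor
    · rintro ⟨j, hj, rfl⟩
      simp only [List.length_ofFn, lt_min_iff] at hj
      refine ⟨_, ⟨⟨j, hj.2⟩, hj.1, rfl⟩, ?_⟩
      simp [MvPolynomial.X_pow_eq_monomial]
    · rintro ⟨_, ⟨j, hj, rfl⟩, rfl⟩
      refine ⟨j, by simp [hj], ?_⟩
      simp [MvPolynomial.X_pow_eq_monomial]
  rw [isSMulRegular_quotient_iff_mem_of_smul_mem]
  intro p hp
  rw [smul_eq_mul, Ideal.mul_top, hI, MvPolynomial.mem_ideal_span_monomial_image] at hp ⊢
  intro m hm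
  simp only [List.getElem_ofFn] at hp
  have := hp (m + Finsupp.single ⟨i, hin⟩ t) (by
    rw [MvPolynomial.mem_support_iff] at hm ⊢
    rw [smul_eq_mul, MvPolynomial.X_pow_eq_monomial, add_comm, MvPolynomial.coeff_monomial_mul]
    simpa using hm)
  obtain ⟨_, ⟨j, hj, rfl⟩, hle⟩ := this
  refine ⟨_, ⟨j, hj, rfl⟩, ?_⟩
  rw [Finsupp.single_le_iff] at hle ⊢
  have hne : (⟨i, hin⟩ : Fin n) ≠ j := by rintro rfl; simp at hj
  simpa [Finsupp.single_apply, hne] using hle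

variable {R : Type} [CommRing R]

lemma pd_le (M : ModuleCat.{0} R) (rs : List R) (m : ℕ) (reg : IsWeaklyRegular M rs)
    (hM : HasProjectiveDimensionLT M (m + 1)) :
    HasProjectiveDimensionLT
      (ModuleCat.of R (M ⧸ Ideal.ofList rs • (⊤ : Submodule R M))) (m + rs.length + 1) := by
  induction rs generalizing M m with
  | nil =>
    have e : M ≅ ModuleCat.of R (M ⧸ Ideal.ofList ([] : List R) • (⊤ : Submodule R M)) :=
      (Submodule.quotEquivOfEqBot _ (by simp)).toModuleIso.symm
    exact hasProjectiveDimensionLT_of_iso e _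
  | cons x rs ih =>
    rw [isWeaklyRegular_cons_iff] at reg
    have h1 : HasProjectiveDimensionLT (ModuleCat.of R (QuotSMulTop x M)) (m + 1 + 1) :=
      reg.1.smulShortComplex_shortExact.hasProjectiveDimensionLT_X₃ (m + 1) hM
        (hasProjectiveDimensionLT_of_ge M (m + 1) (m + 2) (Nat.le_add_right _ 1))
    have h2 := ih (ModuleCat.of R (QuotSMulTop x M)) (m + 1) reg.2 h1
    have e := (Submodule.quotOfListConsSMulTopEquivQuotSMulTopInner M x rs).toModuleIso.symm
    have h3 := hasProjectiveDimensionLT_of_iso e (m + 1 + rs.length + 1)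
    have : m + (x :: rs).length + 1 = m + 1 + rs.length + 1 := by simp; omega
    rw [this]
    exact h3

lemma ext_nontrivial [IsNoetherianRing R] (N M : ModuleCat.{0} R) [Module.Finite R N]
    [Module.Finite R M] (rs : List R) (reg : IsRegular M rs)
    (Nsupp : Module.support R N ⊆ PrimeSpectrum.zeroLocus (Ideal.ofList rs : Set R))
    (h : Nontrivial (N →ₗ[R] (M ⧸ Ideal.ofList rs • (⊤ : Submodule R M)))) :
    Nontrivial (Abelian.Ext N M rs.length) := by
  induction rs generalizing M with
  | nil =>
    have e : (M ⧸ Ideal.ofList ([] : List R) • (⊤ : Submodule R M)) ≃ₗ[R] M :=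
      (Submodule.quotEquivOfEqBot _ (by simp))
    have : Nontrivial (N →ₗ[R] M) := (LinearEquiv.congrRight (M := N) e).symm.toEquiv.nontrivial
    exact (Ext.addEquiv₀.trans ModuleCat.homAddEquiv).toEquiv.nontrivial
  | cons x rs ih =>
    have hv := ModuleCat.subsingleton_ext_of_exists_isRegular (Ideal.ofList (x :: rs)) N Nsupp M
      reg.top_ne_smul.symm.lt_top (x :: rs) (fun r hr => Ideal.subset_span hr) reg
    rw [isRegular_cons_iff] at reg
    have h1 := ih (ModuleCat.of R (QuotSMulTop x M)) reg.2
      (Nsupp.trans (PrimeSpectrum.zeroLocus_anti_mono_ideal (by simp [Ideal.ofList_cons])))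
      ((LinearEquiv.congrRight (M := N)
        (Submodule.quotOfListConsSMulTopEquivQuotSMulTopInner M x rs)).symm.toEquiv.nontrivial)
    obtain ⟨a, ha⟩ := exists_ne
      (0 : Abelian.Ext N (ModuleCat.of R (QuotSMulTop x M)) rs.length)
    have hS := reg.1.smulShortComplex_shortExact
    refine ⟨(a : Abelian.Ext N (M.smulShortComplex x).X₃ rs.length).comp hS.extClass rfl, 0,
      fun h0 => ha ?_⟩
    obtain ⟨b, hb⟩ := Ext.covariant_sequence_exact₃ N hS a rfl h0
    have := hv rs.length (by simp)
    have hb0 : b = 0 := this.elim _ _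
    rw [← hb, hb0, Ext.zero_comp]
    rfl

lemma ext_transition [IsNoetherianRing R] (M : ModuleCat.{0} R) [Module.Finite R M]
    (rs : List R) (reg : IsRegular M rs)
    {X X' : ModuleCat.{0} R} (g : X' ⟶ X) [Epi g] [Module.Finite R X']
    (hsupp : Module.support R X' ⊆ PrimeSpectrum.zeroLocus (Ideal.ofList rs : Set R))
    (a : Abelian.Ext X M rs.length)
    (h : (Ext.mk₀ g).comp a (zero_add _) = 0) : a = 0 := by
  obtain hlen | ⟨p, hlen⟩ : rs.length = 0 ∨ ∃ p, rs.length = p + 1 := by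
    cases rs.length <;> simp
  · have h0 : ∀ n (hn : n = 0) (a : Abelian.Ext X M n)
      (_ : (Ext.mk₀ g).comp a (zero_add _) = 0), a = 0 := by
      rintro n rfl a h
      exact Ext.precomp_mk₀_injective_of_epi M g
        (h.trans (Ext.comp_zero (Ext.mk₀ g) M 0 0 (zero_add 0)).symm)
    exact h0 _ hlen a h
  · let S : ShortComplex (ModuleCat.{0} R) := g.hom.shortComplexKer
    have hS : S.ShortExact :=
      LinearMap.shortExact_shortComplexKer ((ModuleCat.epi_iff_surjective g).1 inferInstance)
    have hfin : Module.Finite R S.X₁ := by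
      change Module.Finite R (LinearMap.ker g.hom)
      infer_instance
    have hsub : Module.support R S.X₁ ⊆ Module.support R X' :=
      Module.support_subset_of_injective (LinearMap.ker g.hom).subtype
        (Submodule.subtype_injective _)
    have hv := ModuleCat.subsingleton_ext_of_exists_isRegular (Ideal.ofList rs) S.X₁
      (hsub.trans hsupp) M
      reg.top_ne_smul.symm.lt_top rs (fun r hr => Ideal.subset_span hr) reg p (by omega)
    obtain ⟨x, hx⟩ := Ext.contravariant_sequence_exact₃ hS M a h (n₀ := p) (by omega)
    rw [← hx, hv.elim x 0, Ext.comp_zero]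

end Reg
section Colim
open localCohomology RingTheory.Sequence

variable {R : Type} [CommRing R]

/-- a decreasing sequence of ideals as a diagram -/
def dia (𝔪 : Ideal R) (J : ℕ → Ideal R) (hanti : Antitone J) (hrad : ∀ t, 𝔪 ≤ (J t).radical) :
    ℕᵒᵖ ⥤ SelfLERadical 𝔪 :=
  ObjectProperty.lift _
    { obj := fun t => J (unop t)
      map := fun w => ⟨⟨hanti w.unop.down.down⟩⟩ } fun t => hrad (unop t)

lemma dia_initial [IsNoetherianRing R] (𝔪 : Ideal R) (J : ℕ → Ideal R) (hanti : Antitone J)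
    (hrad : ∀ t, 𝔪 ≤ (J t).radical) (hcof : ∀ s, ∃ t, J t ≤ 𝔪 ^ s) :
    Functor.Initial (dia 𝔪 J hanti hrad) where
  out J' := by
    apply +allowSynthFailures zigzag_isConnected
    · obtain ⟨k, hk⟩ := Ideal.exists_pow_le_of_le_radical_of_fg J'.2
        (IsNoetherian.noetherian 𝔪)
      obtain ⟨t, ht⟩ := hcof k
      exact ⟨CostructuredArrow.mk
        (⟨⟨⟨ht.trans hk⟩⟩⟩ : (dia 𝔪 J hanti hrad).obj (op t) ⟶ J')⟩
    · intro j1 j2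
      apply Relation.ReflTransGen.single
      rcases le_total (unop j1.left) (unop j2.left) with h | h
      · right; exact ⟨CostructuredArrow.homMk (homOfLE h).op rfl⟩
      · left; exact ⟨CostructuredArrow.homMk (homOfLE h).op rfl⟩

/-- the diagram of Ext modules -/
abbrev GG (I : ℕᵒᵖ ⥤ Ideal R) (i : ℕ) (M : ModuleCat.{0} R) : ℕᵒᵖᵒᵖ ⥤ ModuleCat.{0} R :=
  diagram I i ⋙ (evaluation _ _).obj M

def lcIso [IsNoetherianRing R] (𝔪 : Ideal R) (J : ℕ → Ideal R) (hanti : Antitone J)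
    (hrad : ∀ t, 𝔪 ≤ (J t).radical) (hcof : ∀ s, ∃ t, J t ≤ 𝔪 ^ s) (i : ℕ)
    (M : ModuleCat.{0} R) :
    (localCohomology 𝔪 i).obj M ≅
      colimit (GG (dia 𝔪 J hanti hrad ⋙ selfLERadicalDiagram 𝔪) i M) :=
  have := dia_initial 𝔪 J hanti hrad hcof
  ((isoSelfLERadical 𝔪 i).symm ≪≫
    (isoOfFinal.{0,0,0} (dia 𝔪 J hanti hrad) (selfLERadicalDiagram 𝔪) i).symm).app M ≪≫
    colimitObjIsoColimitCompEvaluation _ _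

theorem main [IsNoetherianRing R] (n : ℕ) (𝔪 : Ideal R) (rs : ℕ → List R)
    (hlen : ∀ t, (rs t).length = n)
    (hreg : ∀ t, IsRegular R (rs t))
    (hanti : Antitone fun t => Ideal.ofList (rs t))
    (hrad : ∀ t, 𝔪 ≤ (Ideal.ofList (rs t)).radical)
    (hcof : ∀ s, ∃ t, Ideal.ofList (rs t) ≤ 𝔪 ^ s) :
    (∀ i : ℕ, i ≠ n → Subsingleton ((localCohomology 𝔪 i).obj (ModuleCat.of R R))) ∧
    Nontrivial ((localCohomology 𝔪 n).obj (ModuleCat.of R R)) := by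
  let I := dia 𝔪 (fun t => Ideal.ofList (rs t)) hanti hrad ⋙ selfLERadicalDiagram 𝔪
  let M := ModuleCat.of R R
  have hfin : Module.Finite R M := inferInstanceAs (Module.Finite R R)
  have iso := fun i => lcIso 𝔪 (fun t => Ideal.ofList (rs t)) hanti hrad hcof i M
  have hsupp : ∀ t, Module.support R (R ⧸ Ideal.ofList (rs t)) ⊆
      PrimeSpectrum.zeroLocus (Ideal.ofList (rs t) : Set R) := by
    intro t
    rw [Module.support_eq_zeroLocus, Ideal.annihilator_quotient]
  constructor
  · intro i hi
    have hE : ∀ t, Subsingleton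
        (Abelian.Ext (ModuleCat.of R (R ⧸ Ideal.ofList (rs t))) M i) := by
      intro t
      rcases lt_or_gt_of_ne hi with h | h
      · exact ModuleCat.subsingleton_ext_of_exists_isRegular (Ideal.ofList (rs t))
          (ModuleCat.of R (R ⧸ Ideal.ofList (rs t))) (hsupp t) M
          (hreg t).top_ne_smul.symm.lt_top (rs t) (fun r hr => Ideal.subset_span hr) (hreg t) i
          (by rw [hlen]; exact h)
      · have hp : HasProjectiveDimensionLT M (0 + 1) := by
          rw [zero_add, ← projective_iff_hasProjectiveDimensionLT_one]
          exact ModuleCat.projective_of_free (Module.Basis.singleton Unit R)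
        have h1 := pd_le M (rs t) 0 (hreg t).1 hp
        have e : ModuleCat.of R (M ⧸ Ideal.ofList (rs t) • (⊤ : Submodule R M)) ≅
            ModuleCat.of R (R ⧸ Ideal.ofList (rs t)) :=
          (Submodule.quotEquivOfEq (Ideal.ofList (rs t) • (⊤ : Submodule R R))
            (Ideal.ofList (rs t)) (by rw [smul_eq_mul, Ideal.mul_top])).toModuleIso
        have h2 := hasProjectiveDimensionLT_of_iso e (0 + (rs t).length + 1)
        exact HasProjectiveDimensionLT.subsingleton _ (0 + (rs t).length + 1) i
          (by rw [hlen]; omega) M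
    have hz : IsZero (colimit (GG I i M)) := by
      rw [IsZero.iff_id_eq_zero]
      refine colimit.hom_ext fun t => ?_
      have : Subsingleton ((GG I i M).obj t) := EE_subsingleton M i (hE t.unop.unop)
      exact (ModuleCat.isZero_of_subsingleton _).eq_of_src _ _
    exact ModuleCat.subsingleton_of_isZero (hz.of_iso (iso i))
  · have hinj : ∀ {s t : ℕᵒᵖᵒᵖ} (f : s ⟶ t), Function.Injective ((GG I n M).map f) := by
      intro s t f
      let g := (ringModIdeals I).map f.unop
      have hg : Epi g := by
        rw [ModuleCat.epi_iff_surjective]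
        intro y
        obtain ⟨r, rfl⟩ := Submodule.Quotient.mk_surjective _ y
        exact ⟨Submodule.Quotient.mk r, rfl⟩
      have hf' : Module.Finite R ((ringModIdeals I).obj t.unop) :=
        inferInstanceAs (Module.Finite R (R ⧸ Ideal.ofList (rs t.unop.unop)))
      refine EE_map_injective M n g ?_
      have := ext_transition M (rs t.unop.unop) (hreg _) g (hsupp _)
      rw [hlen] at this
      exact this
    have hN : Nontrivial ((GG I n M).obj (op (op 0))) := by
      refine EE_nontrivial M n ?_
      have := ext_nontrivial (ModuleCat.of R (R ⧸ Ideal.ofList (rs 0))) M (rs 0) (hreg 0) (hsupp 0)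
        ?_
      · rw [hlen] at this
        exact this
      · have hq : Nontrivial (R ⧸ Ideal.ofList (rs 0)) := by
          apply Ideal.Quotient.nontrivial_iff.2
          have := (hreg 0).top_ne_smul.symm
          rwa [smul_eq_mul, Ideal.mul_top] at this
        have e : (R ⧸ Ideal.ofList (rs 0)) ≃ₗ[R]
            (R ⧸ Ideal.ofList (rs 0) • (⊤ : Submodule R R)) :=
          (Submodule.quotEquivOfEq (Ideal.ofList (rs 0) • (⊤ : Submodule R R))
            (Ideal.ofList (rs 0)) (by rw [smul_eq_mul, Ideal.mul_top])).symm
        exact (LinearEquiv.congrRight (M := R ⧸ Ideal.ofList (rs 0)) e).symm.toEquiv.nontrivial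
    obtain ⟨x, hx⟩ := exists_ne (0 : (GG I n M).obj (op (op 0)))
    have hC : Nontrivial ↑(colimit (GG I n M)) := by
      refine ⟨colimit.ι (GG I n M) (op (op 0)) x, 0, fun h0 => hx ?_⟩
      rw [← map_zero (colimit.ι (GG I n M) (op (op 0))).hom] at h0
      obtain ⟨k, f, g, hfg⟩ := Concrete.colimit_exists_of_rep_eq (GG I n M) _ _ h0
      have hfg' : f = g := Subsingleton.elim _ _
      subst hfg'
      exact hinj f hfg
    exact (iso n).toLinearEquiv.toEquiv.nontrivial

end Colim
end
end LC

/-- let `N` be a finite-dimensional local commutative `k`-algebra with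
residue field `k` (witnessed by a surjective `k`-algebra map `ε : N → k` with kernel
the maximal ideal), and let `A = k[x_1,…,x_n] ⊗[k] N`.  Let `𝔪` be the kernel of the
`k`-algebra map `A → k` sending every variable to `0` and given by `ε` on `N`.  Then
the local cohomology of `A` with respect to `𝔪` vanishes in all degrees `i ≠ n` and is
nonzero in degree `n`. -/
theorem stmt13 (k : Type) [Field k] (n : ℕ)
    (N : Type) [CommRing N] [Algebra k N] [FiniteDimensional k N] [IsLocalRing N]
    (ε : N →ₐ[k] k) (hsurj : Function.Surjective ε)
    (hker : RingHom.ker (ε : N →+* k) = IsLocalRing.maximalIdeal N)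
    (𝔪 : Ideal (MvPolynomial (Fin n) k ⊗[k] N))
    (h𝔪 : 𝔪 = RingHom.ker ((Algebra.TensorProduct.lift
        (MvPolynomial.aeval fun _ : Fin n => (0 : k)) ε
        (fun x y => Commute.all _ _)).toRingHom)) :
    (∀ i : ℕ, i ≠ n →
      Subsingleton ((localCohomology 𝔪 i).obj
        (ModuleCat.of (MvPolynomial (Fin n) k ⊗[k] N) (MvPolynomial (Fin n) k ⊗[k] N)))) ∧
    Nontrivial ((localCohomology 𝔪 n).obj
      (ModuleCat.of (MvPolynomial (Fin n) k ⊗[k] N) (MvPolynomial (Fin n) k ⊗[k] N))) := by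
  have hfin : Module.Finite (MvPolynomial (Fin n) k) (MvPolynomial (Fin n) k ⊗[k] N) :=
    inferInstance
  have hnoeth : IsNoetherianRing (MvPolynomial (Fin n) k ⊗[k] N) :=
    IsNoetherianRing.of_finite (MvPolynomial (Fin n) k) _
  have hflat : Module.Flat (MvPolynomial (Fin n) k) (MvPolynomial (Fin n) k ⊗[k] N) :=
    inferInstance
  let φ : MvPolynomial (Fin n) k ⊗[k] N →ₐ[k] k := Algebra.TensorProduct.lift
        (MvPolynomial.aeval fun _ : Fin n => (0 : k)) ε
        (fun x y => Commute.all _ _)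
  have hmem : ∀ a, a ∈ 𝔪 ↔ φ a = 0 := by
    intro a; rw [h𝔪]; exact Iff.rfl
  have hφ : ∀ p y, φ (p ⊗ₜ y) = MvPolynomial.aeval (fun _ : Fin n => (0 : k)) p * ε y := by
    intro p y; exact Algebra.TensorProduct.lift_tmul _ _ _ _ _
  have hne : 𝔪 ≠ ⊤ := by
    rw [Ideal.ne_top_iff_one, hmem, map_one]; exact one_ne_zero
  have hX : ∀ i : Fin n, algebraMap (MvPolynomial (Fin n) k) (MvPolynomial (Fin n) k ⊗[k] N)
      (MvPolynomial.X i) ∈ 𝔪 := by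
    intro i
    rw [hmem, Algebra.TensorProduct.algebraMap_apply, Algebra.algebraMap_self_apply, hφ,
      MvPolynomial.aeval_X, zero_mul]
  let rs : ℕ → List (MvPolynomial (Fin n) k ⊗[k] N) := fun t =>
    (List.ofFn fun i : Fin n => (MvPolynomial.X i : MvPolynomial (Fin n) k) ^ (t + 1)).map
      (algebraMap (MvPolynomial (Fin n) k) (MvPolynomial (Fin n) k ⊗[k] N))
  have hof : ∀ t (J : Ideal (MvPolynomial (Fin n) k ⊗[k] N)),
      (∀ i : Fin n, algebraMap (MvPolynomial (Fin n) k) (MvPolynomial (Fin n) k ⊗[k] N)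
        (MvPolynomial.X i) ^ (t + 1) ∈ J) → Ideal.ofList (rs t) ≤ J := by
    intro t J h
    refine Ideal.span_le.2 ?_
    intro a ha
    obtain ⟨b, hb, rfl⟩ := List.mem_map.1 ha
    obtain ⟨i, rfl⟩ := (List.mem_ofFn' _ _).1 hb
    rw [map_pow]
    exact h i
  have hin : ∀ t (i : Fin n), algebraMap (MvPolynomial (Fin n) k) (MvPolynomial (Fin n) k ⊗[k] N)
        (MvPolynomial.X i) ^ (t + 1) ∈ Ideal.ofList (rs t) := by
    intro t i
    refine Ideal.subset_span ?_
    refine List.mem_map.2 ⟨_, (List.mem_ofFn' _ _).2 ⟨i, rfl⟩, ?_⟩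
    rw [map_pow]
  have hle : ∀ t, Ideal.ofList (rs t) ≤ 𝔪 := fun t =>
    hof t _ fun i => Ideal.pow_mem_of_mem _ (hX i) _ (Nat.succ_pos _)
  refine LC.main n 𝔪 rs ?_ ?_ ?_ ?_ ?_
  · intro t; simp [rs]
  · intro t
    refine ⟨(LC.weaklyRegular_X_pow k n (t + 1)).of_flat, ?_⟩
    rw [smul_eq_mul, Ideal.mul_top]
    intro h
    exact hne (top_le_iff.1 (h ▸ hle t))
  · intro t t' htt'
    refine hof t' _ fun i => ?_
    exact Ideal.mem_of_dvd _ (pow_dvd_pow _ (by omega)) (hin t i)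
  · intro t
    let J := (Ideal.ofList (rs t)).radical
    have hXJ : ∀ i : Fin n, algebraMap (MvPolynomial (Fin n) k) (MvPolynomial (Fin n) k ⊗[k] N)
      (MvPolynomial.X i) ∈ J := fun i => ⟨t + 1, hin t i⟩
    have hart : IsArtinianRing N := IsArtinianRing.of_finite k N
    have hN : ∀ y : N, ε y = 0 → (1 : MvPolynomial (Fin n) k) ⊗ₜ[k] y ∈ J := by
      intro y hy
      have h1 : y ∈ IsLocalRing.maximalIdeal N := hker ▸ hy
      obtain ⟨m, hm⟩ : IsNilpotent y := by
        have := IsArtinianRing.isNilpotent_jacobson_bot (R := N)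
        rw [IsLocalRing.jacobson_eq_maximalIdeal ⊥ bot_ne_top] at this
        obtain ⟨m, hm⟩ := this
        refine ⟨m, ?_⟩
        have h2 := Ideal.pow_mem_pow h1 m
        rw [hm] at h2
        exact h2
      refine ⟨m, ?_⟩
      rw [Algebra.TensorProduct.tmul_pow, hm, TensorProduct.tmul_zero]
      exact zero_mem _
    let π := Ideal.Quotient.mkₐ k J
    have key : π = (Algebra.ofId k _).comp φ := by
      apply Algebra.TensorProduct.ext
      · apply MvPolynomial.algHom_ext
        intro i
        change π (MvPolynomial.X i ⊗ₜ 1) = Algebra.ofId k _ (φ (MvPolynomial.X i ⊗ₜ 1))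
        rw [hφ, MvPolynomial.aeval_X, zero_mul, map_zero]
        exact Ideal.Quotient.eq_zero_iff_mem.2 (hXJ i)
      · ext y
        change π (1 ⊗ₜ y) = Algebra.ofId k _ (φ (1 ⊗ₜ y))
        rw [hφ, map_one, one_mul]
        have h3 := hN (y - algebraMap k N (ε y)) (by
          rw [map_sub, AlgHom.commutes, Algebra.algebraMap_self_apply, sub_self])
        have h4 : π (1 ⊗ₜ (y - algebraMap k N (ε y))) = 0 := Ideal.Quotient.eq_zero_iff_mem.2 h3
        rw [TensorProduct.tmul_sub, map_sub, sub_eq_zero] at h4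
        rw [h4, Algebra.ofId_apply, ← AlgHom.commutes π,
          ← Algebra.TensorProduct.algebraMap_apply' ]
    intro a ha
    apply Ideal.Quotient.eq_zero_iff_mem.1
    have := congrArg (fun f => f a) key
    refine this.trans ?_
    change Algebra.ofId k _ (φ a) = 0
    rw [(hmem a).1 ha, map_zero]
  · intro s
    refine ⟨s, hof s _ fun i => ?_⟩
    exact Ideal.pow_le_pow_right (Nat.le_succ s) (Ideal.pow_mem_pow (hX i) _)
end
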